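/- arXiv:gr-qc/0308055 — 3 statements merged into one kernel-verified Lean document; each statement's English description precedes it below -/
import Mathlib

section
/- The quantity C₂(t) = ∫₀¹ (∫_{ℝ³} f(t,θ,v₁,v₂,v₃) dv₁ dv₂ dv₃) dθ is constant in t on (t_p, t_i]; that is, the total number of Vlasov particles is conserved by the evolution. -/
open MeasureTheory Set

noncomputable section

set_option linter.unusedVariables false

/-- the velocity space `ℝ³` -/
abbrev V3 : Type := ℝ × ℝ × ℝ

/-- partial derivative with respect to the time variable `t` -/
def pt (F : ℝ → ℝ → ℝ) : ℝ → ℝ → ℝ := fun t θ => deriv (fun s => F s θ) t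

/-- partial derivative with respect to the space variable `θ` -/
def pθ (F : ℝ → ℝ → ℝ) : ℝ → ℝ → ℝ := fun t θ => deriv (fun x => F t x) θ

/-- time derivative within `Ici tp` (one-sided at the left endpoint `tp`) -/
def ptW (tp : ℝ) (F : ℝ → ℝ → ℝ) : ℝ → ℝ → ℝ :=
  fun t θ => derivWithin (fun s => F s θ) (Set.Ici tp) t

/-- time derivative of the matter distribution function -/
def ptf (f : ℝ → ℝ → V3 → ℝ) (t θ : ℝ) (v : V3) : ℝ := deriv (fun s => f s θ v) t

/-- one-sided time derivative of the matter distribution function -/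
def ptWf (tp : ℝ) (f : ℝ → ℝ → V3 → ℝ) (t θ : ℝ) (v : V3) : ℝ :=
  derivWithin (fun s => f s θ v) (Set.Ici tp) t

/-- `θ`-derivative of the matter distribution function -/
def pθf (f : ℝ → ℝ → V3 → ℝ) (t θ : ℝ) (v : V3) : ℝ := deriv (fun x => f t x v) θ

/-- derivative in the first velocity variable `v₁` -/
def pv1 (g : V3 → ℝ) (v : V3) : ℝ := deriv (fun y => g (y, v.2.1, v.2.2)) v.1

/-- derivative in the second velocity variable `v₂` -/
def pv2 (g : V3 → ℝ) (v : V3) : ℝ := deriv (fun y => g (v.1, y, v.2.2)) v.2.1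

/-- derivative in the third velocity variable `v₃` -/
def pv3 (g : V3 → ℝ) (v : V3) : ℝ := deriv (fun y => g (v.1, v.2.1, y)) v.2.2

/-- the velocity component `v₀ = −√(α e^{2ν−2U} + α v₁² + α e^{2ν−4U} v₂² + α t⁻² e^{2ν} (v₃ − A v₂)²)` -/
def v0 (α ν U A : ℝ → ℝ → ℝ) (t θ : ℝ) (v : V3) : ℝ :=
  - Real.sqrt (α t θ * Real.exp (2 * ν t θ - 2 * U t θ)
    + α t θ * v.1 ^ 2
    + α t θ * Real.exp (2 * ν t θ - 4 * U t θ) * v.2.1 ^ 2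
    + α t θ * (t ^ 2)⁻¹ * Real.exp (2 * ν t θ) * (v.2.2 - A t θ * v.2.1) ^ 2)

/-- `β = ν + (ln α)/2` -/
def betaF (ν α : ℝ → ℝ → ℝ) : ℝ → ℝ → ℝ := fun t θ => ν t θ + Real.log (α t θ) / 2

/-- the energy `𝓔̃(t) = ∫₀¹ ν_t/(√α t) dθ` -/
def Etilde (ν α : ℝ → ℝ → ℝ) (t : ℝ) : ℝ :=
  ∫ θ in (0:ℝ)..1, pt ν t θ / (Real.sqrt (α t θ) * t)

theorem hasDerivAt_setIntegral_of_continuousOn {Y : Type*} [TopologicalSpace Y]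
    [MeasurableSpace Y] [OpensMeasurableSpace Y] [T2Space Y] {μ : Measure Y}
    [IsFiniteMeasureOnCompacts μ] [SecondCountableTopology Y]
    {F F' : ℝ → Y → ℝ} {U : Set ℝ} {k : Set Y} (hU : IsOpen U) (hk : IsCompact k)
    (hF : ContinuousOn (fun p : ℝ × Y => F p.1 p.2) (U ×ˢ univ))
    (hF' : ContinuousOn (fun p : ℝ × Y => F' p.1 p.2) (U ×ˢ univ))
    (hd : ∀ s ∈ U, ∀ y, HasDerivAt (fun s => F s y) (F' s y) s) {s : ℝ} (hs : s ∈ U) :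
    HasDerivAt (fun s => ∫ y in k, F s y ∂μ) (∫ y in k, F' s y ∂μ) s := by
  have slice : ∀ {H : ℝ → Y → ℝ}, ContinuousOn (fun p : ℝ × Y => H p.1 p.2) (U ×ˢ univ) →
      ∀ x ∈ U, Continuous (H x) := fun hH x hx =>
    hH.comp_continuous (by fun_prop : Continuous fun y : Y => (x, y)) (by simp [hx])
  obtain ⟨V, hV, hVU, hVc⟩ := local_compact_nhds (hU.mem_nhds hs)
  obtain ⟨M, hM⟩ := (hVc.prod hk).exists_bound_of_continuousOn
    (hF'.mono (prod_mono hVU (subset_univ k)))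
  have hμk : IsFiniteMeasure (μ.restrict k) := ⟨by simpa using hk.measure_lt_top⟩
  refine (hasDerivAt_integral_of_dominated_loc_of_deriv_le (F := F) (F' := F')
    (bound := fun _ => M) hV ?_ ((slice hF s hs).continuousOn.integrableOn_compact hk)
    (slice hF' s hs).aestronglyMeasurable ?_ (integrable_const M) ?_).2
  · filter_upwards [hU.mem_nhds hs] with x hx using (slice hF x hx).aestronglyMeasurable
  · filter_upwards [ae_restrict_mem hk.measurableSet] with y hy x hx using hM (x, y) ⟨hx, hy⟩
  · filter_upwards with y x hx using hd x (hVU hx) y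

theorem continuousOn_setIntegral_of_continuousOn {Y : Type*} [TopologicalSpace Y]
    [MeasurableSpace Y] [OpensMeasurableSpace Y] [SecondCountableTopology Y] {μ : Measure Y}
    [IsLocallyFiniteMeasure μ] {F : ℝ → Y → ℝ} {S : Set ℝ} {k : Set Y} (hS : IsCompact S)
    (hk : IsCompact k) (hF : ContinuousOn (fun p : ℝ × Y => F p.1 p.2) (S ×ˢ univ)) :
    ContinuousOn (fun s => ∫ y in k, F s y ∂μ) S := by
  rw [continuousOn_iff_continuous_domRestrict]
  have := isCompact_iff_compactSpace.mp hS
  exact continuous_parametric_integral_of_continuous (X := S) (f := fun s y => F s y)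
    (hF.comp_continuous (by fun_prop : Continuous fun p : S × Y => ((p.1 : ℝ), p.2))
      (fun p => ⟨p.1.2, mem_univ _⟩)) hk

theorem setIntegral_rectangle {g : ℝ → ℝ → ℝ} (hg : Continuous fun q : ℝ × ℝ => g q.1 q.2)
    {a b c d : ℝ} (hab : a ≤ b) (hcd : c ≤ d) :
    ∫ q in Icc a b ×ˢ Icc c d, g q.1 q.2 = ∫ x in a..b, ∫ y in c..d, g x y := by
  rw [Measure.volume_eq_prod, setIntegral_prod _
    (hg.continuousOn.integrableOn_compact (isCompact_Icc.prod isCompact_Icc)),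
    intervalIntegral.integral_of_le hab, integral_Icc_eq_integral_Ioc]
  simp only [intervalIntegral.integral_of_le hcd, integral_Icc_eq_integral_Ioc]

theorem setIntegral_rectangle_divergence_eq_zero {B C B' C' : ℝ → ℝ → ℝ} {a b c d : ℝ}
    (hab : a ≤ b) (hcd : c ≤ d)
    (hB' : Continuous fun q : ℝ × ℝ => B' q.1 q.2) (hC' : Continuous fun q : ℝ × ℝ => C' q.1 q.2)
    (hB : ∀ x y, HasDerivAt (fun x => B x y) (B' x y) x)
    (hC : ∀ x y, HasDerivAt (fun y => C x y) (C' x y) y)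
    (hBab : ∀ y, B b y = B a y) (hCcd : ∀ x, C x d = C x c) :
    ∫ q in Icc a b ×ˢ Icc c d, (B' q.1 q.2 - C' q.1 q.2) = 0 := by
  have hk : IsCompact (Icc a b ×ˢ Icc c d) := isCompact_Icc.prod isCompact_Icc
  rw [integral_sub (hB'.continuousOn.integrableOn_compact hk)
    (hC'.continuousOn.integrableOn_compact hk), setIntegral_rectangle hB' hab hcd,
    setIntegral_rectangle hC' hab hcd, intervalIntegral_intervalIntegral_swap
      ((hB'.continuousOn.integrableOn_compact hk).mono_set (by
        rw [uIoc_of_le hab, uIoc_of_le hcd]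
        exact prod_mono Ioc_subset_Icc_self Ioc_subset_Icc_self))]
  have h1 : ∀ y, ∫ x in a..b, B' x y = 0 := fun y => by
    rw [intervalIntegral.integral_eq_sub_of_hasDerivAt (fun x _ => hB x y)
      (Continuous.intervalIntegrable (by fun_prop) _ _), hBab, sub_self]
  have h2 : ∀ x, ∫ y in c..d, C' x y = 0 := fun x => by
    rw [intervalIntegral.integral_eq_sub_of_hasDerivAt (fun y _ => hC x y)
      (Continuous.intervalIntegrable (by fun_prop) _ _), hCcd, sub_self]
  simp [h1, h2]

/-- The characteristic vector field of the Hamiltonian `-√(a + α y²)` with external force `G`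
is divergence free, so that transport along it integrates to zero. -/
theorem setIntegral_transport_eq_zero {a α a' α' G : ℝ → ℝ} {k k₁ k₂ : ℝ → ℝ → ℝ} {ρ : ℝ}
    (hρ : 0 ≤ ρ) (ha : ∀ x, HasDerivAt a (a' x) x) (hα : ∀ x, HasDerivAt α (α' x) x)
    (ha' : Continuous a') (hα' : Continuous α') (hG : Continuous G)
    (hapos : ∀ x, 0 < a x) (hαpos : ∀ x, 0 < α x) (haper : a 1 = a 0) (hαper : α 1 = α 0)
    (hk : Continuous fun q : ℝ × ℝ => k q.1 q.2)
    (hk₁ : Continuous fun q : ℝ × ℝ => k₁ q.1 q.2) (hk₂ : Continuous fun q : ℝ × ℝ => k₂ q.1 q.2)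
    (hd₁ : ∀ x y, HasDerivAt (fun x => k x y) (k₁ x y) x)
    (hd₂ : ∀ x y, HasDerivAt (fun y => k x y) (k₂ x y) y)
    (hkper : ∀ y, k 1 y = k 0 y) (hkρ : ∀ x, k x ρ = 0) (hkρ' : ∀ x, k x (-ρ) = 0) :
    ∫ q in Icc (0 : ℝ) 1 ×ˢ Icc (-ρ) ρ,
      (-(α q.1 * q.2) / √(a q.1 + α q.1 * q.2 ^ 2) * k₁ q.1 q.2
        - (-(a' q.1 + α' q.1 * q.2 ^ 2) / (2 * √(a q.1 + α q.1 * q.2 ^ 2)) + G q.1) * k₂ q.1 q.2)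
      = 0 := by
  have hac : Continuous a := continuous_iff_continuousAt.2 fun x => (ha x).continuousAt
  have hαc : Continuous α := continuous_iff_continuousAt.2 fun x => (hα x).continuousAt
  have hQ : ∀ x y, 0 < a x + α x * y ^ 2 := fun x y =>
    add_pos_of_pos_of_nonneg (hapos x) (mul_nonneg (hαpos x).le (sq_nonneg y))
  have hS : ∀ x y, √(a x + α x * y ^ 2) ≠ 0 := fun x y => (Real.sqrt_pos.2 (hQ x y)).ne'
  set S : ℝ → ℝ → ℝ := fun x y => √(a x + α x * y ^ 2) with hSdef
  have hSc : Continuous fun q : ℝ × ℝ => S q.1 q.2 := by simp only [hSdef]; fun_prop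
  have hS₁ : ∀ x y, HasDerivAt (fun x => S x y) ((a' x + α' x * y ^ 2) / (2 * S x y)) x :=
    fun x y => ((ha x).add ((hα x).mul_const _)).sqrt (hQ x y).ne'
  have hS₂ : ∀ x y, HasDerivAt (fun y => S x y) (α x * y / S x y) y := fun x y => by
    have := (((hasDerivAt_pow 2 y).const_mul (α x)).const_add (a x)).sqrt (hQ x y).ne'
    refine this.congr_deriv ?_
    have := hS x y
    simp only [hSdef]
    field_simp
    norm_num
  have key := setIntegral_rectangle_divergence_eq_zero (a := 0) (b := 1) (c := -ρ) (d := ρ)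
    (B := fun x y => -(α x * y) / S x y * k x y)
    (C := fun x y => (-(a' x + α' x * y ^ 2) / (2 * S x y) + G x) * k x y)
    (B' := fun x y => (-(α' x * y) * S x y - -(α x * y) * ((a' x + α' x * y ^ 2) / (2 * S x y)))
      / S x y ^ 2 * k x y + -(α x * y) / S x y * k₁ x y)
    (C' := fun x y => (-(α' x * (2 * y)) * (2 * S x y)
      - -(a' x + α' x * y ^ 2) * (2 * (α x * y / S x y))) / (2 * S x y) ^ 2 * k x y
      + (-(a' x + α' x * y ^ 2) / (2 * S x y) + G x) * k₂ x y) zero_le_one (by linarith)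
    (by fun_prop (disch := intros; simp [hSdef, hS]))
    (by fun_prop (disch := intros; simp [hSdef, hS]))
    (fun x y => ((((hα x).mul_const y).neg).div (hS₁ x y) (hS x y)).mul (hd₁ x y))
    (fun x y => by
      have h := ((((hasDerivAt_pow 2 y).const_mul (α' x)).const_add (a' x)).neg.div
        ((hS₂ x y).const_mul 2) (mul_ne_zero two_ne_zero (hS x y))).add_const (G x)
      refine (h.mul (hd₂ x y)).congr_deriv ?_
      simp)
    (fun y => by simp [hSdef, haper, hαper, hkper])
    (fun x => by simp [hkρ, hkρ'])
  refine Eq.trans (congrArg _ (funext fun q => ?_)) key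
  have := hS q.1 q.2
  simp only [hSdef] at this ⊢
  field_simp
  ring

theorem hasDerivAt_deriv_of_contDiffOn_prod {X : Type*} [NormedAddCommGroup X] [NormedSpace ℝ X]
    {S : Set X} {T : Set ℝ} {k : X → ℝ → ℝ} (hS : UniqueDiffOn ℝ S) (hT : IsOpen T)
    (hk : ContDiffOn ℝ 1 (fun p : X × ℝ => k p.1 p.2) (S ×ˢ T)) :
    (∀ x ∈ S, ∀ y ∈ T, HasDerivAt (k x) (deriv (k x) y) y) ∧
      ContinuousOn (fun p : X × ℝ => deriv (k p.1) p.2) (S ×ˢ T) := by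
  have key : ∀ x ∈ S, ∀ y ∈ T, HasDerivAt (k x)
      (fderivWithin ℝ (fun p : X × ℝ => k p.1 p.2) (S ×ˢ T) (x, y) (0, 1)) y := by
    intro x hx y hy
    have h1 := (hk.differentiableOn one_ne_zero (x, y) ⟨hx, hy⟩).hasFDerivWithinAt
    have h2 : HasDerivWithinAt (fun z : ℝ => (x, z)) ((0 : X), (1 : ℝ)) T y :=
      ((hasDerivAt_const y x).prodMk (hasDerivAt_id y)).hasDerivWithinAt
    exact (h1.comp_hasDerivWithinAt y h2 (fun z hz => ⟨hx, hz⟩)).hasDerivAt (hT.mem_nhds hy)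
  refine ⟨fun x hx y hy => (key x hx y hy).differentiableAt.hasDerivAt, ?_⟩
  have hc := (hk.continuousOn_fderivWithin (hS.prod hT.uniqueDiffOn) le_rfl).clm_apply
    (continuousOn_const (c := ((0 : X), (1 : ℝ))))
  exact hc.congr fun p hp => (key p.1 hp.1 p.2 hp.2).deriv

theorem exists_bound_of_continuousOn_of_periodic {h : ℝ → ℝ → ℝ} {S : Set ℝ} (hS : IsCompact S)
    (hc : ContinuousOn (fun p : ℝ × ℝ => h p.1 p.2) (S ×ˢ univ))
    (hper : ∀ s θ, h s (θ + 1) = h s θ) : ∃ M : ℝ, ∀ s ∈ S, ∀ θ, |h s θ| ≤ M := by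
  obtain ⟨M, hM⟩ := (hS.prod (isCompact_Icc (a := (0 : ℝ)) (b := 1))).exists_bound_of_continuousOn
    (hc.mono (prod_mono_right (subset_univ _)))
  refine ⟨M, fun s hs θ => ?_⟩
  have hp : Function.Periodic (h s) 1 := hper s
  have : h s θ = h s (Int.fract θ) := by
    rw [← hp.sub_int_mul_eq ⌊θ⌋, mul_one, Int.self_sub_floor]
  rw [this]
  exact hM (s, Int.fract θ) ⟨hs, Int.fract_nonneg θ, (Int.fract_lt_one θ).le⟩

/-- The total mass of a subsolution of the transport equation does not increase. -/
theorem setIntegral_le_of_transport_le {a α G : ℝ → ℝ → ℝ} {g : ℝ → ℝ → ℝ → ℝ} {t₁ t₂ ρ : ℝ}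
    (ht : t₁ ≤ t₂) (hρ : 0 ≤ ρ)
    (ha : ContDiffOn ℝ 1 (fun p : ℝ × ℝ => a p.1 p.2) (Ioo t₁ t₂ ×ˢ univ))
    (hα : ContDiffOn ℝ 1 (fun p : ℝ × ℝ => α p.1 p.2) (Ioo t₁ t₂ ×ˢ univ))
    (hG : ContinuousOn (fun p : ℝ × ℝ => G p.1 p.2) (Ioo t₁ t₂ ×ˢ univ))
    (hg : ContDiffOn ℝ 1 (fun p : ℝ × ℝ × ℝ => g p.1 p.2.1 p.2.2) (Ioo t₁ t₂ ×ˢ univ))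
    (hgc : ContinuousOn (fun p : ℝ × ℝ × ℝ => g p.1 p.2.1 p.2.2) (Icc t₁ t₂ ×ˢ univ))
    (hapos : ∀ t ∈ Ioo t₁ t₂, ∀ x, 0 < a t x) (hαpos : ∀ t ∈ Ioo t₁ t₂, ∀ x, 0 < α t x)
    (haper : ∀ t x, a t (x + 1) = a t x) (hαper : ∀ t x, α t (x + 1) = α t x)
    (hgper : ∀ t x y, g t (x + 1) y = g t x y)
    (hgρ : ∀ t ∈ Ioo t₁ t₂, ∀ x y, ρ ≤ |y| → g t x y = 0)
    (hle : ∀ t ∈ Ioo t₁ t₂, ∀ x y, deriv (fun s => g s x y) t ≤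
      -(α t x * y) / √(a t x + α t x * y ^ 2) * deriv (fun x => g t x y) x
        - (-(deriv (a t) x + deriv (α t) x * y ^ 2) / (2 * √(a t x + α t x * y ^ 2)) + G t x)
          * deriv (g t x) y) :
    ∫ q in Icc (0 : ℝ) 1 ×ˢ Icc (-ρ) ρ, g t₂ q.1 q.2
      ≤ ∫ q in Icc (0 : ℝ) 1 ×ˢ Icc (-ρ) ρ, g t₁ q.1 q.2 := by
  have hk : IsCompact (Icc (0 : ℝ) 1 ×ˢ Icc (-ρ) ρ) := isCompact_Icc.prod isCompact_Icc
  have hgt := hasDerivAt_deriv_of_contDiffOn_prod (X := ℝ × ℝ) (S := univ) (T := Ioo t₁ t₂)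
    (k := fun q s => g s q.1 q.2) uniqueDiffOn_univ isOpen_Ioo
    (hg.comp (f := fun p : (ℝ × ℝ) × ℝ => (p.2, p.1)) (by fun_prop) fun p hp => ⟨hp.2, hp.1⟩)
  have hgtc : ContinuousOn (fun p : ℝ × ℝ × ℝ => deriv (fun s => g s p.2.1 p.2.2) p.1)
      (Ioo t₁ t₂ ×ˢ univ) :=
    hgt.2.comp (f := fun p : ℝ × ℝ × ℝ => (p.2, p.1)) (by fun_prop) fun p hp => ⟨hp.2, hp.1⟩
  have hderiv : ∀ t ∈ Ioo t₁ t₂, HasDerivAt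
      (fun s => ∫ q in Icc (0 : ℝ) 1 ×ˢ Icc (-ρ) ρ, g s q.1 q.2)
      (∫ q in Icc (0 : ℝ) 1 ×ˢ Icc (-ρ) ρ, deriv (fun s => g s q.1 q.2) t) t := fun t htm =>
    hasDerivAt_setIntegral_of_continuousOn (F := fun s (q : ℝ × ℝ) => g s q.1 q.2)
      (F' := fun t q => deriv (fun s => g s q.1 q.2) t) isOpen_Ioo hk hg.continuousOn hgtc
      (fun s hs q => hgt.1 q (mem_univ q) s hs) htm
  refine antitoneOn_of_deriv_nonpos (convex_Icc t₁ t₂)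
    (continuousOn_setIntegral_of_continuousOn (F := fun s (q : ℝ × ℝ) => g s q.1 q.2)
      isCompact_Icc hk hgc) ?_ ?_ (left_mem_Icc.2 ht) (right_mem_Icc.2 ht) ht
  · rw [interior_Icc]
    exact fun t htm => (hderiv t htm).differentiableAt.differentiableWithinAt
  rw [interior_Icc]
  intro t htm
  rw [(hderiv t htm).deriv]
  have hgs : ContDiff ℝ 1 (fun q : ℝ × ℝ => g t q.1 q.2) := contDiffOn_univ.1
    (hg.comp (f := fun q : ℝ × ℝ => (t, q)) (by fun_prop) fun q _ => ⟨htm, mem_univ q⟩)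
  have slice : ∀ {b : ℝ → ℝ → ℝ},
      ContDiffOn ℝ 1 (fun p : ℝ × ℝ => b p.1 p.2) (Ioo t₁ t₂ ×ˢ univ) →
      (∀ x, HasDerivAt (b t) (deriv (b t) x) x) ∧ Continuous (deriv (b t)) := fun hb => by
    have h : ContDiff ℝ 1 _ := contDiffOn_univ.1
      (hb.comp (f := fun x : ℝ => (t, x)) (by fun_prop) fun x _ => ⟨htm, mem_univ x⟩)
    exact ⟨fun x => (h.differentiable one_ne_zero x).hasDerivAt, h.continuous_deriv le_rfl⟩
  have hy := hasDerivAt_deriv_of_contDiffOn_prod (S := univ) (T := univ) (k := g t)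
    uniqueDiffOn_univ isOpen_univ (by simpa using hgs.contDiffOn)
  have hx := hasDerivAt_deriv_of_contDiffOn_prod (S := univ) (T := univ) (k := fun y x => g t x y)
    uniqueDiffOn_univ isOpen_univ
    (hgs.comp (f := fun p : ℝ × ℝ => (p.2, p.1)) (by fun_prop)).contDiffOn
  simp only [univ_prod_univ, continuousOn_univ, mem_univ, true_imp_iff] at hx hy
  have hx2 : Continuous fun q : ℝ × ℝ => deriv (fun x => g t x q.2) q.1 :=
    hx.2.comp (continuous_swap)
  have hGt : Continuous (G t) :=
    hG.comp_continuous (f := fun x : ℝ => (t, x)) (by fun_prop) fun x => ⟨htm, mem_univ x⟩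
  have key := setIntegral_transport_eq_zero hρ (slice ha).1 (slice hα).1 (slice ha).2 (slice hα).2
    hGt (hapos t htm) (hαpos t htm) (by simpa using haper t 0) (by simpa using hαper t 0)
    hgs.continuous hx2 hy.2 (fun x y => hx.1 y x) hy.1 (fun y => by simpa using hgper t 0 y)
    (fun x => hgρ t htm x ρ (le_abs_self ρ)) (fun x => hgρ t htm x (-ρ) (by simp [le_abs_self]))
  refine le_trans ?_ key.le
  have hac := continuous_iff_continuousAt.2 fun x => ((slice ha).1 x).continuousAt
  have hαc := continuous_iff_continuousAt.2 fun x => ((slice hα).1 x).continuousAt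
  have ha' := (slice ha).2
  have hα' := (slice hα).2
  have hy2 := hy.2
  refine setIntegral_mono
    ((hgtc.comp_continuous (f := fun q : ℝ × ℝ => (t, q)) (by fun_prop)
      fun q => ⟨htm, mem_univ q⟩).continuousOn.integrableOn_compact hk)
    (ContinuousOn.integrableOn_compact (μ := volume) hk (Continuous.continuousOn ?_)) fun q => hle t htm q.1 q.2
  have hS : ∀ q : ℝ × ℝ, √(a t q.1 + α t q.1 * q.2 ^ 2) ≠ 0 := fun q => (Real.sqrt_pos.2
    (add_pos_of_pos_of_nonneg (hapos t htm _) (mul_nonneg (hαpos t htm _).le (sq_nonneg _)))).ne'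
  fun_prop (disch := intros; simp [hS])

theorem integrable_restrict_prod_of_eq_zero {V : Type*} [NormedAddCommGroup V] [ProperSpace V]
    [SecondCountableTopology V] [MeasurableSpace V] [BorelSpace V] {μ : Measure V}
    [IsFiniteMeasureOnCompacts μ] [SFinite μ] {F : ℝ → V → ℝ} {R : ℝ}
    (hF : Continuous (Function.uncurry F)) (hR : ∀ θ v, R < ‖v‖ → F θ v = 0) :
    Integrable (Function.uncurry F) ((volume.restrict (uIoc (0 : ℝ) 1)).prod μ) := by
  have h : IntegrableOn (Function.uncurry F) (Icc (0 : ℝ) 1 ×ˢ Metric.closedBall 0 R)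
      ((volume : Measure ℝ).prod μ) := hF.continuousOn.integrableOn_compact
    (isCompact_Icc.prod (isCompact_closedBall 0 R))
  rw [← Measure.restrict_univ (μ := μ), Measure.prod_restrict]
  refine IntegrableOn.of_forall_sdiff_eq_zero h (measurableSet_uIoc.prod MeasurableSet.univ) ?_
  rintro ⟨θ, v⟩ ⟨⟨hθ, -⟩, hn⟩
  rw [uIoc_of_le zero_le_one] at hθ
  exact hR θ v (not_le.1 fun hv => hn ⟨Ioc_subset_Icc_self hθ, by simpa using hv⟩)

theorem integral_velocity_fubini {F : ℝ → V3 → ℝ} {R : ℝ}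
    (hF : Continuous (Function.uncurry F)) (hR : ∀ θ v, R < ‖v‖ → F θ v = 0) :
    ∫ θ in (0 : ℝ)..1, ∫ v : V3, F θ v
      = ∫ u : ℝ × ℝ, ∫ θ in (0 : ℝ)..1, ∫ y : ℝ, F θ (y, u) := by
  have hint := integrable_restrict_prod_of_eq_zero (μ := (volume : Measure V3)) hF hR
  rw [intervalIntegral_integral_swap hint]
  have hint' : Integrable (fun v : V3 => ∫ θ in (0 : ℝ)..1, F θ v) := by
    have := hint.integral_prod_right
    rw [uIoc_of_le zero_le_one] at this
    simpa only [intervalIntegral.integral_of_le zero_le_one, Function.uncurry_apply_pair] using this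
  rw [Measure.volume_eq_prod] at hint' ⊢
  rw [integral_prod_symm _ hint']
  congr 1 with u
  refine (intervalIntegral_integral_swap (integrable_restrict_prod_of_eq_zero
    (F := fun θ y => F θ (y, u)) (μ := volume) (R := R) ?_ ?_)).symm
  · exact hF.comp (by fun_prop : Continuous fun p : ℝ × ℝ => (p.1, (p.2, u)))
  · exact fun θ y hy => hR θ _ (hy.trans_le (norm_fst_le (y, u)))

theorem abs_mul_force_le {a α a' α' g y Ma Mα Mi Mg : ℝ} (ha : 0 ≤ a) (hα : 0 < α)
    (ha' : |a'| ≤ Ma) (hα' : |α'| ≤ Mα) (hi : 1 / √α ≤ Mi) (hg : |g| ≤ Mg) :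
    |2 * y * (-(a' + α' * y ^ 2) / (2 * √(a + α * y ^ 2)) + g)|
      ≤ ((Ma + Mα) * Mi + Mg) * (1 + y ^ 2) := by
  have hMa : 0 ≤ Ma := (abs_nonneg _).trans ha'
  have hMα : 0 ≤ Mα := (abs_nonneg _).trans hα'
  have hMi : 0 ≤ Mi := le_trans (by positivity) hi
  have hMg : 0 ≤ Mg := (abs_nonneg _).trans hg
  have hy : |y| / √(a + α * y ^ 2) ≤ Mi := by
    rcases eq_or_ne y 0 with rfl | hy0
    · simpa using hMi
    refine le_trans ?_ hi
    have h1 : √α * |y| ≤ √(a + α * y ^ 2) := by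
      rw [← Real.sqrt_sq_eq_abs, ← Real.sqrt_mul hα.le]
      exact Real.sqrt_le_sqrt (by linarith)
    have h2 : 0 < √α := Real.sqrt_pos.2 hα
    have h3 : 0 < √(a + α * y ^ 2) := lt_of_lt_of_le (by positivity) h1
    rw [div_le_div_iff₀ h3 h2]
    linarith
  have hn : |a' + α' * y ^ 2| ≤ (Ma + Mα) * (1 + y ^ 2) := by
    have h1 : |a' + α' * y ^ 2| ≤ |a'| + |α'| * y ^ 2 := by
      refine (abs_add_le a' (α' * y ^ 2)).trans_eq ?_
      rw [abs_mul α', abs_of_nonneg (sq_nonneg y)]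
    have h2 : |α'| * y ^ 2 ≤ Mα * y ^ 2 := by gcongr
    nlinarith [mul_nonneg hMa (sq_nonneg y)]
  have hG : |2 * y| * |g| ≤ (1 + y ^ 2) * Mg := by
    gcongr
    rw [abs_le]
    constructor <;> nlinarith [sq_nonneg (y - 1), sq_nonneg (y + 1)]
  have hsplit : 2 * y * (-(a' + α' * y ^ 2) / (2 * √(a + α * y ^ 2)) + g)
      = -((a' + α' * y ^ 2) * (y / √(a + α * y ^ 2))) + 2 * y * g := by
    rcases eq_or_ne (√(a + α * y ^ 2)) 0 with h | h
    · simp [h]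
    · field_simp
  rw [hsplit]
  refine (abs_add_le _ _).trans ?_
  rw [abs_neg, abs_mul, abs_mul (2 * y), abs_div, abs_of_nonneg (Real.sqrt_nonneg _)]
  calc _ ≤ (Ma + Mα) * (1 + y ^ 2) * Mi + (1 + y ^ 2) * Mg := by gcongr
    _ = _ := by ring

/-- Smooth velocity cutoff, equal to one for `exp (μ s) * (1 + y ^ 2) ≤ R` and vanishing for
`exp (μ s) * (1 + y ^ 2) ≥ 2 * R`. -/
def velocityCutoff (μ R s y : ℝ) : ℝ :=
  Real.smoothTransition (2 - Real.exp (μ * s) * (1 + y ^ 2) / R)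

theorem contDiff_velocityCutoff (μ R : ℝ) :
    ContDiff ℝ 1 fun p : ℝ × ℝ => velocityCutoff μ R p.1 p.2 :=
  (Real.smoothTransition.contDiff (n := 1)).comp
    (by fun_prop : ContDiff ℝ 1 fun p : ℝ × ℝ => 2 - Real.exp (μ * p.1) * (1 + p.2 ^ 2) / R)

theorem velocityCutoff_eq_one {μ R s y : ℝ} (hR : 0 < R)
    (h : Real.exp (μ * s) * (1 + y ^ 2) ≤ R) : velocityCutoff μ R s y = 1 := by
  refine Real.smoothTransition.one_of_one_le ?_
  have := (div_le_one hR).2 h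
  linarith

theorem velocityCutoff_eq_zero {μ R s y : ℝ} (hR : 0 < R)
    (h : 2 * R ≤ Real.exp (μ * s) * (1 + y ^ 2)) : velocityCutoff μ R s y = 0 := by
  refine Real.smoothTransition.zero_of_nonpos ?_
  have := (le_div_iff₀ hR).2 h
  linarith

theorem exists_hasDerivAt_velocityCutoff (μ : ℝ) {R : ℝ} (hR : 0 < R) (s y : ℝ) :
    ∃ D : ℝ, 0 ≤ D ∧ HasDerivAt (fun s => velocityCutoff μ R s y) (-(D * (μ * (1 + y ^ 2)))) s ∧
      HasDerivAt (fun y => velocityCutoff μ R s y) (-(D * (2 * y))) y := by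
  set z : ℝ := 2 - Real.exp (μ * s) * (1 + y ^ 2) / R
  have hd : HasDerivAt Real.smoothTransition (deriv Real.smoothTransition z) z :=
    ((Real.smoothTransition.contDiff (n := 1)).differentiable one_ne_zero z).hasDerivAt
  refine ⟨deriv Real.smoothTransition z * (Real.exp (μ * s) / R),
    mul_nonneg Real.smoothTransition.monotone.deriv_nonneg (by positivity), ?_, ?_⟩
  · have h := ((((hasDerivAt_id s).const_mul μ).exp.mul_const (1 + y ^ 2)).div_const R).const_sub 2
    refine (hd.comp s h).congr_deriv ?_
    simp only [id]
    ring
  · have h := ((((hasDerivAt_pow 2 y).const_add 1).const_mul (Real.exp (μ * s))).div_const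
      R).const_sub 2
    refine (hd.comp y h).congr_deriv ?_
    norm_num
    ring

/-- Mass conservation for the one-dimensional Vlasov equation with Hamiltonian `-√(a + α y²)` and
external force `G`. The support in `y` is bounded for each time, with no uniformity in time. -/
theorem integral_transport_conserved {tp ti : ℝ} (htp : 0 < tp) {a α G : ℝ → ℝ → ℝ}
    {f : ℝ → ℝ → ℝ → ℝ}
    (ha : ContDiffOn ℝ 1 (fun p : ℝ × ℝ => a p.1 p.2) (Ioc tp ti ×ˢ univ))
    (hα : ContDiffOn ℝ 1 (fun p : ℝ × ℝ => α p.1 p.2) (Ioc tp ti ×ˢ univ))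
    (hG : ContinuousOn (fun p : ℝ × ℝ => G p.1 p.2) (Ioc tp ti ×ˢ univ))
    (hf : ContDiffOn ℝ 1 (fun p : ℝ × ℝ × ℝ => f p.1 p.2.1 p.2.2) (Ioc tp ti ×ˢ univ))
    (hapos : ∀ t ∈ Ioc tp ti, ∀ x, 0 < a t x) (hαpos : ∀ t ∈ Ioc tp ti, ∀ x, 0 < α t x)
    (haper : ∀ t x, a t (x + 1) = a t x) (hαper : ∀ t x, α t (x + 1) = α t x)
    (hGper : ∀ t x, G t (x + 1) = G t x) (hfper : ∀ t x y, f t (x + 1) y = f t x y)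
    (hfnn : ∀ t ∈ Ioc tp ti, ∀ x y, 0 ≤ f t x y)
    (hfsupp : ∀ t ∈ Ioc tp ti, ∃ r : ℝ, ∀ x y, r < |y| → f t x y = 0)
    (hV : ∀ t ∈ Ioo tp ti, ∀ x y, deriv (fun s => f s x y) t =
      -(α t x * y) / √(a t x + α t x * y ^ 2) * deriv (fun x => f t x y) x
        - (-(deriv (a t) x + deriv (α t) x * y ^ 2) / (2 * √(a t x + α t x * y ^ 2)) + G t x)
          * deriv (f t x) y) {t : ℝ} (ht : t ∈ Ioc tp ti) :
    ∫ x in (0 : ℝ)..1, ∫ y, f t x y = ∫ x in (0 : ℝ)..1, ∫ y, f ti x y := by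
  have hti : ti ∈ Ioc tp ti := ⟨ht.1.trans_le ht.2, le_rfl⟩
  have hIcc : Icc t ti ⊆ Ioc tp ti := fun s hs => ⟨ht.1.trans_le hs.1, hs.2⟩
  have hIoo : Ioo t ti ⊆ Ioc tp ti := Ioo_subset_Icc_self.trans hIcc
  have bound := fun {h : ℝ → ℝ → ℝ} => exists_bound_of_continuousOn_of_periodic (h := h)
    (isCompact_Icc (a := t) (b := ti))
  have per_deriv : ∀ {h : ℝ → ℝ → ℝ}, (∀ s θ, h s (θ + 1) = h s θ) →
      ∀ s θ, deriv (h s) (θ + 1) = deriv (h s) θ := fun {h} hper s θ => by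
    rw [← deriv_comp_add_const]
    simp only [hper]
  have derivC := fun {h : ℝ → ℝ → ℝ} => hasDerivAt_deriv_of_contDiffOn_prod (k := h)
    (uniqueDiffOn_Ioc tp ti) isOpen_univ
  obtain ⟨Ma, hMa⟩ := bound ((derivC ha).2.mono (prod_mono_left hIcc)) (per_deriv haper)
  obtain ⟨Mα, hMα⟩ := bound ((derivC hα).2.mono (prod_mono_left hIcc)) (per_deriv hαper)
  obtain ⟨Mg, hMg⟩ := bound (hG.mono (prod_mono_left hIcc)) hGper
  obtain ⟨Mi, hMi⟩ := bound (h := fun s x => 1 / √(α s x))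
    ((continuousOn_const.div hα.continuousOn.sqrt
      fun p hp => (Real.sqrt_pos.2 (hαpos p.1 hp.1 p.2)).ne').mono (prod_mono_left hIcc))
    (fun s x => by simp only [hαper])
  set L : ℝ := (Ma + Mα) * Mi + Mg with hL
  obtain ⟨r₁, hr₁⟩ := hfsupp t ht
  obtain ⟨r₂, hr₂⟩ := hfsupp ti hti
  set r : ℝ := max 0 (max r₁ r₂)
  have hr0 : 0 ≤ r := le_max_left _ _
  have hrt : ∀ s, s = t ∨ s = ti → ∀ x y, r < |y| → f s x y = 0 := by
    rintro s (rfl | rfl) x y hy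
    · exact hr₁ x y (lt_of_le_of_lt ((le_max_left _ _).trans (le_max_right _ _)) hy)
    · exact hr₂ x y (lt_of_le_of_lt ((le_max_right _ _).trans (le_max_right _ _)) hy)
  have main : ∀ σ : ℝ, σ = 1 ∨ σ = -1 →
      σ * ∫ x in (0 : ℝ)..1, ∫ y, f ti x y ≤ σ * ∫ x in (0 : ℝ)..1, ∫ y, f t x y := by
    intro σ hσ
    have hσ2 : σ * σ = 1 := by rcases hσ with rfl | rfl <;> norm_num
    have hσabs : |σ| = 1 := by rcases hσ with rfl | rfl <;> norm_num
    set μ : ℝ := σ * L with hμ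
    set R : ℝ := Real.exp (μ * t) * (1 + r ^ 2) + Real.exp (μ * ti) * (1 + r ^ 2)
    have hRpos : 0 < R := by positivity
    set ρ : ℝ := 2 * R * Real.exp (|μ| * ti) + r + 1
    have hρr : r < ρ := by
      have : 0 < 2 * R * Real.exp (|μ| * ti) := by positivity
      linarith
    have hρ0 : 0 ≤ ρ := hr0.trans hρr.le
    have hcut : ∀ s, s = t ∨ s = ti → ∀ x y, f s x y * velocityCutoff μ R s y = f s x y := by
      intro s hs x y
      rcases le_or_gt |y| r with hy | hy
      · rw [velocityCutoff_eq_one hRpos, mul_one]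
        have hy2 : y ^ 2 ≤ r ^ 2 := sq_le_sq' (abs_le.1 hy).1 (abs_le.1 hy).2
        have h1 : Real.exp (μ * s) * (1 + y ^ 2) ≤ Real.exp (μ * s) * (1 + r ^ 2) := by gcongr
        have h2 : 0 ≤ Real.exp (μ * t) * (1 + r ^ 2) := by positivity
        have h3 : 0 ≤ Real.exp (μ * ti) * (1 + r ^ 2) := by positivity
        rcases hs with rfl | rfl <;> linarith
      · rw [hrt s hs x y hy, zero_mul]
    have hcut0 : ∀ s ∈ Ioo t ti, ∀ y, ρ ≤ |y| → velocityCutoff μ R s y = 0 := by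
      intro s hs y hy
      refine velocityCutoff_eq_zero hRpos ?_
      have hs0 : 0 < s := htp.trans (ht.1.trans hs.1)
      have h1 : 2 * R * Real.exp (|μ| * ti) ≤ 1 + y ^ 2 := by
        nlinarith [sq_abs y, sq_nonneg (|y| - 1), abs_nonneg y]
      have h2 : 1 ≤ Real.exp (μ * s) * Real.exp (|μ| * ti) := by
        rw [← Real.exp_add, Real.one_le_exp_iff]
        have h3 : -(|μ| * s) ≤ μ * s := by nlinarith [neg_abs_le μ]
        have h4 : |μ| * s ≤ |μ| * ti := by gcongr; exact hs.2.le
        linarith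
      calc 2 * R ≤ 2 * R * (Real.exp (μ * s) * Real.exp (|μ| * ti)) :=
            le_mul_of_one_le_right (by positivity) h2
        _ = Real.exp (μ * s) * (2 * R * Real.exp (|μ| * ti)) := by ring
        _ ≤ _ := by gcongr
    have hslice : ∀ s ∈ Ioc tp ti, Continuous fun q : ℝ × ℝ => f s q.1 q.2 := fun s hs =>
      hf.continuousOn.comp_continuous (f := fun q : ℝ × ℝ => (s, q)) (by fun_prop)
        fun q => ⟨hs, mem_univ q⟩
    have mass : ∀ s, s = t ∨ s = ti → ∫ q in Icc (0 : ℝ) 1 ×ˢ Icc (-ρ) ρ,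
        σ * (f s q.1 q.2 * velocityCutoff μ R s q.2) = σ * ∫ x in (0 : ℝ)..1, ∫ y, f s x y := by
      intro s hs
      have hsm : s ∈ Ioc tp ti := by rcases hs with rfl | rfl <;> assumption
      simp only [hcut s hs]
      rw [integral_const_mul, setIntegral_rectangle (hslice s hsm) zero_le_one (by linarith)]
      congr 2 with x
      refine intervalIntegral.integral_eq_integral_of_support_subset fun y hy => ?_
      have : |y| ≤ r := not_lt.1 fun h => hy (hrt s hs x y h)
      exact ⟨by linarith [(abs_le.1 this).1], by linarith [(abs_le.1 this).2]⟩
    rw [← mass t (Or.inl rfl), ← mass ti (Or.inr rfl)]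
    have hg : ContDiffOn ℝ 1 (fun p : ℝ × ℝ × ℝ =>
        σ * (f p.1 p.2.1 p.2.2 * velocityCutoff μ R p.1 p.2.2)) (Ioc tp ti ×ˢ univ) :=
      contDiffOn_const.mul (hf.mul ((contDiff_velocityCutoff μ R).comp
        (by fun_prop : ContDiff ℝ 1 fun p : ℝ × ℝ × ℝ => (p.1, p.2.2))).contDiffOn)
    refine setIntegral_le_of_transport_le
      (g := fun s x y => σ * (f s x y * velocityCutoff μ R s y)) (G := G) ht.2 hρ0
      (ha.mono (prod_mono_left hIoo)) (hα.mono (prod_mono_left hIoo))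
      (hG.mono (prod_mono_left hIoo)) (hg.mono (prod_mono_left hIoo))
      (hg.continuousOn.mono (prod_mono_left hIcc)) (fun s hs => hapos s (hIoo hs))
      (fun s hs => hαpos s (hIoo hs)) haper hαper (fun s x y => by simp only [hfper])
      (fun s hs x y hy => by simp [hcut0 s hs y hy]) ?_
    intro s hs x y
    have hsm := hIoo hs
    have hat : ContDiffAt ℝ 1 (fun p : ℝ × ℝ × ℝ => f p.1 p.2.1 p.2.2) (s, x, y) :=
      (hf.mono (prod_mono_left hIoo)).contDiffAt ((isOpen_Ioo.prod isOpen_univ).mem_nhds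
        ⟨hs, mem_univ _⟩)
    have hdiff := hat.differentiableAt one_ne_zero
    have d₀ : HasDerivAt (fun s => f s x y) (deriv (fun s => f s x y) s) s :=
      (hdiff.comp s (f := fun s : ℝ => (s, x, y)) (by fun_prop)).hasDerivAt
    have d₁ : HasDerivAt (fun x => f s x y) (deriv (fun x => f s x y) x) x :=
      (hdiff.comp x (f := fun x : ℝ => (s, x, y)) (by fun_prop)).hasDerivAt
    have d₂ : HasDerivAt (f s x) (deriv (f s x) y) y :=
      (hdiff.comp y (f := fun y : ℝ => (s, x, y)) (by fun_prop)).hasDerivAt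
    obtain ⟨D, hD, hw₀, hw₂⟩ := exists_hasDerivAt_velocityCutoff μ hRpos s y
    have e₀ : HasDerivAt (fun s => σ * (f s x y * velocityCutoff μ R s y)) _ s :=
      (d₀.mul hw₀).const_mul σ
    have e₁ : HasDerivAt (fun x => σ * (f s x y * velocityCutoff μ R s y)) _ x :=
      (d₁.mul_const _).const_mul σ
    have e₂ : HasDerivAt (fun y => σ * (f s x y * velocityCutoff μ R s y)) _ y :=
      (d₂.mul hw₂).const_mul σ
    rw [e₀.deriv, e₁.deriv, e₂.deriv, hV s ⟨hsm.1, hs.2⟩]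
    have hF := abs_mul_force_le (y := y) (hapos s hsm x).le (hαpos s hsm x)
      (hMa s (Ioo_subset_Icc_self hs) x) (hMα s (Ioo_subset_Icc_self hs) x)
      ((le_abs_self _).trans (hMi s (Ioo_subset_Icc_self hs) x))
      (hMg s (Ioo_subset_Icc_self hs) x)
    rw [← hL] at hF
    set Φ := -(deriv (a s) x + deriv (α s) x * y ^ 2) / (2 * √(a s x + α s x * y ^ 2)) + G s x
    have hσF : 0 ≤ L * (1 + y ^ 2) + σ * (2 * y * Φ) := by
      have h := neg_abs_le (σ * (2 * y * Φ))
      rw [abs_mul, hσabs, one_mul] at h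
      linarith
    have hpos := mul_nonneg (mul_nonneg (hfnn s hsm x y) hD) hσF
    rw [hμ]
    linear_combination hpos - f s x y * D * L * (1 + y ^ 2) * hσ2
  have h1 := main 1 (Or.inl rfl)
  have h2 := main (-1) (Or.inr rfl)
  linarith

theorem hasDerivAt_neg_sqrt_fst {a α a' α' : ℝ → ℝ} {x : ℝ} (ha : HasDerivAt a (a' x) x)
    (hα : HasDerivAt α (α' x) x) (hapos : 0 < a x) (hαpos : 0 < α x) (y : ℝ) :
    HasDerivAt (fun x => -√(a x + α x * y ^ 2))
      (-(a' x + α' x * y ^ 2) / (2 * √(a x + α x * y ^ 2))) x := by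
  have hQ : 0 < a x + α x * y ^ 2 :=
    add_pos_of_pos_of_nonneg hapos (mul_nonneg hαpos.le (sq_nonneg y))
  exact ((ha.add (hα.mul_const (y ^ 2))).sqrt hQ.ne').neg.congr_deriv (neg_div _ _).symm

theorem hasDerivAt_neg_sqrt_snd {a α : ℝ} (ha : 0 < a) (hα : 0 < α) (y : ℝ) :
    HasDerivAt (fun y => -√(a + α * y ^ 2)) (-(α * y) / √(a + α * y ^ 2)) y := by
  have hQ : 0 < a + α * y ^ 2 := add_pos_of_pos_of_nonneg ha (mul_nonneg hα.le (sq_nonneg y))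
  refine ((((hasDerivAt_pow 2 y).const_mul α).const_add a).sqrt hQ.ne').neg.congr_deriv ?_
  have := (Real.sqrt_pos.2 hQ).ne'
  field_simp
  norm_num

/-- The part of `v₀²` that does not involve `v₁`, for `(v₂, v₃) = u`. -/
def transverseEnergy (α ν U A : ℝ → ℝ → ℝ) (u : ℝ × ℝ) (t θ : ℝ) : ℝ :=
  α t θ * Real.exp (2 * ν t θ - 2 * U t θ)
    + α t θ * Real.exp (2 * ν t θ - 4 * U t θ) * u.1 ^ 2
    + α t θ * (t ^ 2)⁻¹ * Real.exp (2 * ν t θ) * (u.2 - A t θ * u.1) ^ 2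

/-- The twist force acting on `v₁`, for `(v₂, v₃) = u`. -/
def twistForce (α ν U A J K : ℝ → ℝ → ℝ) (u : ℝ × ℝ) (t θ : ℝ) : ℝ :=
  Real.sqrt (α t θ) * Real.exp (2 * ν t θ) / t ^ 3 * (K t θ - A t θ * J t θ) * (u.2 - A t θ * u.1)
    + Real.sqrt (α t θ) * Real.exp (2 * ν t θ - 4 * U t θ) / t * J t θ * u.1

theorem v0_eq_neg_sqrt_transverseEnergy (α ν U A : ℝ → ℝ → ℝ) (u : ℝ × ℝ) (t θ y : ℝ) :
    v0 α ν U A t θ (y, u) = -√(transverseEnergy α ν U A u t θ + α t θ * y ^ 2) := by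
  simp only [v0, transverseEnergy]
  ring_nf

theorem particle_number_conserved
    (tp ti : ℝ) (htp : 0 < tp) (hti : tp < ti)
    (U A ν α J K : ℝ → ℝ → ℝ) (f : ℝ → ℝ → V3 → ℝ)
    (hUsm : ContDiffOn ℝ (⊤ : ℕ∞) (fun p : ℝ × ℝ => U p.1 p.2) (Ioc tp ti ×ˢ (univ : Set ℝ)))
    (hAsm : ContDiffOn ℝ (⊤ : ℕ∞) (fun p : ℝ × ℝ => A p.1 p.2) (Ioc tp ti ×ˢ (univ : Set ℝ)))
    (hνsm : ContDiffOn ℝ (⊤ : ℕ∞) (fun p : ℝ × ℝ => ν p.1 p.2) (Ioc tp ti ×ˢ (univ : Set ℝ)))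
    (hαsm : ContDiffOn ℝ (⊤ : ℕ∞) (fun p : ℝ × ℝ => α p.1 p.2) (Ioc tp ti ×ˢ (univ : Set ℝ)))
    (hJsm : ContDiffOn ℝ (⊤ : ℕ∞) (fun p : ℝ × ℝ => J p.1 p.2) (Ioc tp ti ×ˢ (univ : Set ℝ)))
    (hKsm : ContDiffOn ℝ (⊤ : ℕ∞) (fun p : ℝ × ℝ => K p.1 p.2) (Ioc tp ti ×ˢ (univ : Set ℝ)))
    (hfsm : ContDiffOn ℝ (⊤ : ℕ∞) (fun p : ℝ × ℝ × V3 => f p.1 p.2.1 p.2.2) (Ioc tp ti ×ˢ (univ : Set (ℝ × V3))))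
    (hUper : ∀ t θ, U t (θ + 1) = U t θ)
    (hAper : ∀ t θ, A t (θ + 1) = A t θ)
    (hνper : ∀ t θ, ν t (θ + 1) = ν t θ)
    (hαper : ∀ t θ, α t (θ + 1) = α t θ)
    (hJper : ∀ t θ, J t (θ + 1) = J t θ)
    (hKper : ∀ t θ, K t (θ + 1) = K t θ)
    (hfper : ∀ t θ v, f t (θ + 1) v = f t θ v)
    (hαpos : ∀ t ∈ Ioc tp ti, ∀ θ : ℝ, 0 < α t θ)
    (hfnn : ∀ t ∈ Ioc tp ti, ∀ (θ : ℝ) (v : V3), 0 ≤ f t θ v)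
    (hfsupp : ∀ t ∈ Ioc tp ti, ∃ R : ℝ, ∀ (θ : ℝ) (v : V3), R < ‖v‖ → f t θ v = 0)
    (hvlasov :
      ∀ t ∈ Ioc tp ti, ∀ (θ : ℝ) (v : V3),
      ptf f t θ v
        = pv1 (v0 α ν U A t θ) v * pθf f t θ v
          - (deriv (fun x => v0 α ν U A t x v) θ
              + Real.sqrt (α t θ) * Real.exp (2 * ν t θ) / t ^ 3 * (K t θ - A t θ * J t θ) * (v.2.2 - A t θ * v.2.1)
              + Real.sqrt (α t θ) * Real.exp (2 * ν t θ - 4 * U t θ) / t * J t θ * v.2.1)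
            * pv1 (f t θ) v) :
    ∀ t ∈ Ioc tp ti,
      (∫ θ in (0:ℝ)..1, ∫ v : V3, f t θ v) = ∫ θ in (0:ℝ)..1, ∫ v : V3, f ti θ v := by
  intro t ht
  have ht0 : ∀ p ∈ Ioc tp ti ×ˢ (univ : Set ℝ), p.1 ≠ 0 := fun p hp => (htp.trans hp.1.1).ne'
  have le1 : ∀ {X : Type} [NormedAddCommGroup X] [NormedSpace ℝ X] {F : X → ℝ} {s : Set X},
      ContDiffOn ℝ (⊤ : ℕ∞) F s → ContDiffOn ℝ 1 F s := fun h => h.of_le (by norm_cast)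
  have hslice : ∀ s ∈ Ioc tp ti, Continuous (Function.uncurry (f s)) := fun s hs =>
    hfsm.continuousOn.comp_continuous (f := fun q : ℝ × V3 => (s, q)) (by fun_prop)
      fun q => ⟨hs, mem_univ q⟩
  have hti' : ti ∈ Ioc tp ti := ⟨hti, le_rfl⟩
  obtain ⟨R, hR⟩ := hfsupp t ht
  obtain ⟨R', hR'⟩ := hfsupp ti hti'
  rw [integral_velocity_fubini (hslice t ht) hR, integral_velocity_fubini (hslice ti hti') hR']
  congr 1 with u
  have hU := le1 hUsm
  have hA := le1 hAsm
  have hν := le1 hνsm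
  have hα := le1 hαsm
  have hpos : ∀ s ∈ Ioc tp ti, ∀ x, 0 < transverseEnergy α ν U A u s x := fun s hs x => by
    have := hαpos s hs x
    unfold transverseEnergy
    positivity
  have ha : ContDiffOn ℝ 1 (fun p : ℝ × ℝ => transverseEnergy α ν U A u p.1 p.2)
      (Ioc tp ti ×ˢ univ) := by
    have hinv : ContDiffOn ℝ 1 (fun p : ℝ × ℝ => (p.1 ^ 2)⁻¹) (Ioc tp ti ×ˢ univ) :=
      ContDiffOn.inv (by fun_prop) fun p hp => pow_ne_zero 2 (ht0 p hp)
    unfold transverseEnergy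
    fun_prop
  have hG : ContinuousOn (fun p : ℝ × ℝ => twistForce α ν U A J K u p.1 p.2)
      (Ioc tp ti ×ˢ univ) := by
    have hUc := hUsm.continuousOn
    have hAc := hAsm.continuousOn
    have hνc := hνsm.continuousOn
    have hαc := hαsm.continuousOn
    have hJc := hJsm.continuousOn
    have hKc := hKsm.continuousOn
    have hinv : ContinuousOn (fun p : ℝ × ℝ => p.1⁻¹) (Ioc tp ti ×ˢ univ) :=
      continuousOn_fst.inv₀ ht0
    have hinv3 : ContinuousOn (fun p : ℝ × ℝ => (p.1 ^ 3)⁻¹) (Ioc tp ti ×ˢ univ) :=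
      (continuousOn_fst.pow 3).inv₀ fun p hp => pow_ne_zero 3 (ht0 p hp)
    simp only [twistForce, div_eq_mul_inv]
    fun_prop
  refine integral_transport_conserved (f := fun s x y => f s x (y, u)) htp ha hα hG
    ((le1 hfsm).comp (f := fun p : ℝ × ℝ × ℝ => (p.1, p.2.1, (p.2.2, u)))
      (by fun_prop) fun p hp => ⟨hp.1, mem_univ _⟩) hpos hαpos
    (fun s x => by simp only [transverseEnergy, hUper, hAper, hνper, hαper]) hαper
    (fun s x => by simp only [twistForce, hUper, hAper, hνper, hαper, hJper, hKper])
    (fun s x y => hfper s x _) (fun s hs x y => hfnn s hs x _)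
    (fun s hs => ?_) (fun s hs x y => ?_) ht
  · obtain ⟨r, hr⟩ := hfsupp s hs
    exact ⟨r, fun x y hy => hr x _ (hy.trans_le (norm_fst_le (y, u)))⟩
  have hsm : s ∈ Ioc tp ti := Ioo_subset_Ioc_self hs
  have diff : ∀ {b : ℝ → ℝ → ℝ}, ContDiffOn ℝ 1 (fun p : ℝ × ℝ => b p.1 p.2) (Ioc tp ti ×ˢ univ) →
      HasDerivAt (b s) (deriv (b s) x) x := fun hb =>
    (hasDerivAt_deriv_of_contDiffOn_prod (uniqueDiffOn_Ioc tp ti) isOpen_univ hb).1 s hsm x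
      (mem_univ x)
  have h := hvlasov s hsm x (y, u)
  simp only [ptf, pθf, pv1, v0_eq_neg_sqrt_transverseEnergy, Prod.mk.eta] at h
  rw [(hasDerivAt_neg_sqrt_snd (hpos s hsm x) (hαpos s hsm x) y).deriv,
    (hasDerivAt_neg_sqrt_fst (diff ha) (diff hα) (hpos s hsm x) (hαpos s hsm x) y).deriv,
    add_assoc] at h
  exact h
end
end

section
/- For every real number b, the function t^{b²/8} √(α) e^{2ν + bU} is nondecreasing in t along each θ; consequently √(α(t,θ)) e^{2ν(t,θ) + bU(t,θ)} ≤ (t_i/t_p)^{b²/8} √(α(t_i,θ)) e^{2ν(t_i,θ) + bU(t_i,θ)} for all (t,θ) ∈ (t_p,t_i] × ℝ, so that √α e^{2ν+bU} is bounded on (t_p,t_i] × ℝ. -/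
open MeasureTheory Set

noncomputable section

set_option linter.unusedVariables false

/-- The time slice of a function smooth on a half-open time strip is differentiable at interior
times. -/
lemma hasDerivAt_pt_of_contDiffOn {tp ti : ℝ} {F : ℝ → ℝ → ℝ}
    (hF : ContDiffOn ℝ (⊤ : ℕ∞) (fun p : ℝ × ℝ => F p.1 p.2) (Ioc tp ti ×ˢ (univ : Set ℝ)))
    {t : ℝ} (ht : t ∈ Ioo tp ti) (θ : ℝ) :
    HasDerivAt (fun s => F s θ) (pt F t θ) t := by
  have hmem : Ioc tp ti ×ˢ (univ : Set ℝ) ∈ nhds (t, θ) :=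
    prod_mem_nhds (Ioc_mem_nhds ht.1 ht.2) Filter.univ_mem
  have hd : DifferentiableAt ℝ (fun p : ℝ × ℝ => F p.1 p.2) (t, θ) :=
    (hF.contDiffAt hmem).differentiableAt (by simp)
  have hg : DifferentiableAt ℝ (fun s : ℝ => (s, θ)) t := by fun_prop
  exact (DifferentiableAt.comp t hd hg).hasDerivAt

lemma continuousOn_time_slice {tp ti : ℝ} {F : ℝ → ℝ → ℝ}
    (hF : ContDiffOn ℝ (⊤ : ℕ∞) (fun p : ℝ × ℝ => F p.1 p.2) (Ioc tp ti ×ˢ (univ : Set ℝ)))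
    (θ : ℝ) : ContinuousOn (fun s => F s θ) (Ioc tp ti) :=
  hF.continuousOn.comp (f := fun s : ℝ => (s, θ)) (by fun_prop) fun _ hs => ⟨hs, mem_univ _⟩

lemma v0_sq_eq (α ν U A : ℝ → ℝ → ℝ) {t θ : ℝ} (hα : 0 ≤ α t θ) (v : V3) :
    |v0 α ν U A t θ v| ^ 2 = α t θ * v.1 ^ 2 + α t θ * Real.exp (2 * ν t θ)
      * (Real.exp (-2 * U t θ) + Real.exp (-4 * U t θ) * v.2.1 ^ 2
        + (t ^ 2)⁻¹ * (v.2.2 - A t θ * v.2.1) ^ 2) := by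
  have h2 : Real.exp (2 * ν t θ - 2 * U t θ) = Real.exp (2 * ν t θ) * Real.exp (-2 * U t θ) := by
    rw [← Real.exp_add]; congr 1; ring
  have h4 : Real.exp (2 * ν t θ - 4 * U t θ) = Real.exp (2 * ν t θ) * Real.exp (-4 * U t θ) := by
    rw [← Real.exp_add]; congr 1; ring
  rw [v0, abs_neg, sq_abs, Real.sq_sqrt (by positivity), h2, h4]
  ring

lemma continuous_v0 (α ν U A : ℝ → ℝ → ℝ) (t θ : ℝ) : Continuous (v0 α ν U A t θ) := by
  unfold v0
  fun_prop

/-- The pressure-type momentum integral is dominated by the energy density of the matter. -/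
lemma integral_div_abs_v0_le (α ν U A : ℝ → ℝ → ℝ) {t θ : ℝ} (hα : 0 < α t θ) {g : V3 → ℝ}
    (hg : Continuous g) (hgs : HasCompactSupport g) (hg0 : ∀ v, 0 ≤ g v) :
    α t θ * Real.exp (2 * ν t θ) * ∫ v : V3, g v
      * (Real.exp (-2 * U t θ) + Real.exp (-4 * U t θ) * v.2.1 ^ 2
        + (t ^ 2)⁻¹ * (v.2.2 - A t θ * v.2.1) ^ 2) / |v0 α ν U A t θ v|
      ≤ ∫ v : V3, g v * |v0 α ν U A t θ v| := by
  rw [← integral_const_mul]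
  refine integral_mono_of_nonneg (Filter.Eventually.of_forall fun v => ?_) ?_
    (Filter.Eventually.of_forall fun v => ?_)
  · have := hg0 v
    simp only [Pi.zero_apply]
    positivity
  · exact (hg.mul (continuous_v0 α ν U A t θ).abs).integrable_of_hasCompactSupport hgs.mul_right
  · have hsq := v0_sq_eq α ν U A hα.le v
    have hpos : 0 < |v0 α ν U A t θ v| := by
      refine (abs_nonneg _).lt_of_ne' fun h0 => ?_
      rw [h0] at hsq
      have : 0 < α t θ * v.1 ^ 2 + α t θ * Real.exp (2 * ν t θ)
          * (Real.exp (-2 * U t θ) + Real.exp (-4 * U t θ) * v.2.1 ^ 2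
            + (t ^ 2)⁻¹ * (v.2.2 - A t θ * v.2.1) ^ 2) := by positivity
      linarith
    simp only
    rw [mul_div_assoc', div_le_iff₀ hpos, mul_assoc (g v), ← sq, hsq]
    have h1 : 0 ≤ g v * (α t θ * v.1 ^ 2) := mul_nonneg (hg0 v) (by positivity)
    linarith

/-- Completing the square in the evolution equations gives a nonnegative logarithmic derivative. -/
lemma log_deriv_nonneg {b t a u uθ q qθ E E' Z w y s I I' n d : ℝ} (ht : 0 < t)
    (ha : 0 ≤ a) (hE : 0 ≤ E) (hI : 0 ≤ I) (hs : 0 ≤ s)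
    (hI' : a * Z * I' ≤ I)
    (hn : n = t * (u ^ 2 + a * uθ ^ 2 + E / (4 * t ^ 2) * (q ^ 2 + a * qθ ^ 2))
      + a * E' / (4 * t) * w ^ 2 + a * Z / (4 * t ^ 3) * y ^ 2 + s * I)
    (hd : d = -(a * E' * w ^ 2 / t) - a * Z * y ^ 2 / t ^ 3 - 2 * (a * s) * Z * I') :
    0 ≤ b ^ 2 / 8 * t⁻¹ + d / 2 + 2 * n + b * u := by
  have key : b ^ 2 / 8 * t⁻¹ + d / 2 + 2 * n + b * u
      = 2 * t * (u + b / (4 * t)) ^ 2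
        + 2 * t * (a * uθ ^ 2 + E / (4 * t ^ 2) * (q ^ 2 + a * qθ ^ 2))
        + s * (I - a * Z * I') + s * I := by
    rw [hn, hd]
    field_simp
    ring
  rw [key]
  have := mul_nonneg hs (sub_nonneg.2 hI')
  positivity

theorem sqrt_alpha_exp_monotone_and_bounded
    (tp ti : ℝ) (htp : 0 < tp) (hti : tp < ti)
    (U A ν α J K : ℝ → ℝ → ℝ) (f : ℝ → ℝ → V3 → ℝ)
    (hUsm : ContDiffOn ℝ (⊤ : ℕ∞) (fun p : ℝ × ℝ => U p.1 p.2) (Ioc tp ti ×ˢ (univ : Set ℝ)))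
    (hAsm : ContDiffOn ℝ (⊤ : ℕ∞) (fun p : ℝ × ℝ => A p.1 p.2) (Ioc tp ti ×ˢ (univ : Set ℝ)))
    (hνsm : ContDiffOn ℝ (⊤ : ℕ∞) (fun p : ℝ × ℝ => ν p.1 p.2) (Ioc tp ti ×ˢ (univ : Set ℝ)))
    (hαsm : ContDiffOn ℝ (⊤ : ℕ∞) (fun p : ℝ × ℝ => α p.1 p.2) (Ioc tp ti ×ˢ (univ : Set ℝ)))
    (hJsm : ContDiffOn ℝ (⊤ : ℕ∞) (fun p : ℝ × ℝ => J p.1 p.2) (Ioc tp ti ×ˢ (univ : Set ℝ)))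
    (hKsm : ContDiffOn ℝ (⊤ : ℕ∞) (fun p : ℝ × ℝ => K p.1 p.2) (Ioc tp ti ×ˢ (univ : Set ℝ)))
    (hfsm : ContDiffOn ℝ (⊤ : ℕ∞) (fun p : ℝ × ℝ × V3 => f p.1 p.2.1 p.2.2) (Ioc tp ti ×ˢ (univ : Set (ℝ × V3))))
    (hUper : ∀ t θ, U t (θ + 1) = U t θ)
    (hAper : ∀ t θ, A t (θ + 1) = A t θ)
    (hνper : ∀ t θ, ν t (θ + 1) = ν t θ)
    (hαper : ∀ t θ, α t (θ + 1) = α t θ)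
    (hJper : ∀ t θ, J t (θ + 1) = J t θ)
    (hKper : ∀ t θ, K t (θ + 1) = K t θ)
    (hfper : ∀ t θ v, f t (θ + 1) v = f t θ v)
    (hαpos : ∀ t ∈ Ioc tp ti, ∀ θ : ℝ, 0 < α t θ)
    (hfnn : ∀ t ∈ Ioc tp ti, ∀ (θ : ℝ) (v : V3), 0 ≤ f t θ v)
    (hfsupp : ∀ t ∈ Ioc tp ti, ∃ R : ℝ, ∀ (θ : ℝ) (v : V3), R < ‖v‖ → f t θ v = 0)
    (hnut :
      ∀ t ∈ Ioc tp ti, ∀ θ : ℝ,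
      (pt ν t θ)
        = t * ((pt U t θ) ^ 2 + α t θ * (pθ U t θ) ^ 2
              + Real.exp (4 * U t θ) / (4 * t ^ 2) * ((pt A t θ) ^ 2 + α t θ * (pθ A t θ) ^ 2))
          + α t θ * Real.exp (2 * ν t θ - 4 * U t θ) / (4 * t) * J t θ ^ 2
          + α t θ * Real.exp (2 * ν t θ) / (4 * t ^ 3) * (K t θ - A t θ * J t θ) ^ 2
          + Real.sqrt (α t θ) * ∫ v : V3, f t θ v * |v0 α ν U A t θ v|)
    (halt :
      ∀ t ∈ Ioc tp ti, ∀ θ : ℝ,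
      (pt α t θ) / α t θ
        = - (α t θ * Real.exp (2 * ν t θ - 4 * U t θ) * J t θ ^ 2 / t)
          - α t θ * Real.exp (2 * ν t θ) * (K t θ - A t θ * J t θ) ^ 2 / t ^ 3
          - 2 * (α t θ * Real.sqrt (α t θ)) * Real.exp (2 * ν t θ)
            * ∫ v : V3, f t θ v
                * (Real.exp (-2 * U t θ) + Real.exp (-4 * U t θ) * v.2.1 ^ 2
                    + (t ^ 2)⁻¹ * (v.2.2 - A t θ * v.2.1) ^ 2)
                / |v0 α ν U A t θ v|) :
    ∀ b : ℝ,
      (∀ θ : ℝ, MonotoneOn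
        (fun t : ℝ => t ^ (b ^ 2 / 8) * Real.sqrt (α t θ) * Real.exp (2 * ν t θ + b * U t θ))
        (Ioc tp ti))
      ∧ ∀ t ∈ Ioc tp ti, ∀ θ : ℝ,
          Real.sqrt (α t θ) * Real.exp (2 * ν t θ + b * U t θ)
            ≤ (ti / tp) ^ (b ^ 2 / 8) * Real.sqrt (α ti θ) * Real.exp (2 * ν ti θ + b * U ti θ) := by
  intro b
  have hmono : ∀ θ : ℝ, MonotoneOn
      (fun t : ℝ => t ^ (b ^ 2 / 8) * Real.sqrt (α t θ) * Real.exp (2 * ν t θ + b * U t θ))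
      (Ioc tp ti) := by
    intro θ
    have hL : MonotoneOn (fun t : ℝ =>
        b ^ 2 / 8 * Real.log t + Real.log (α t θ) / 2 + 2 * ν t θ + b * U t θ) (Ioc tp ti) := by
      have hder : ∀ t ∈ Ioo tp ti, HasDerivAt (fun t : ℝ =>
          b ^ 2 / 8 * Real.log t + Real.log (α t θ) / 2 + 2 * ν t θ + b * U t θ)
          (b ^ 2 / 8 * t⁻¹ + pt α t θ / α t θ / 2 + 2 * pt ν t θ + b * pt U t θ) t := by
        intro t ht
        have hα := (hasDerivAt_pt_of_contDiffOn hαsm ht θ).log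
          (hαpos t (Ioo_subset_Ioc_self ht) θ).ne'
        exact ((((Real.hasDerivAt_log (htp.trans ht.1).ne').const_mul _).add
          (hα.div_const 2)).add ((hasDerivAt_pt_of_contDiffOn hνsm ht θ).const_mul 2)).add
          ((hasDerivAt_pt_of_contDiffOn hUsm ht θ).const_mul b)
      refine monotoneOn_of_deriv_nonneg (convex_Ioc tp ti) ?_ ?_ ?_
      · have hlog : ContinuousOn Real.log (Ioc tp ti) :=
          Real.continuousOn_log.mono fun t ht => (htp.trans ht.1).ne'
        have hα := (continuousOn_time_slice hαsm θ).log fun t ht => (hαpos t ht θ).ne'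
        exact (((hlog.const_mul _).add (hα.div_const 2)).add
          ((continuousOn_time_slice hνsm θ).const_mul 2)).add
          ((continuousOn_time_slice hUsm θ).const_mul b)
      · rw [interior_Ioc]
        exact fun t ht => (hder t ht).differentiableAt.differentiableWithinAt
      · rw [interior_Ioc]
        intro t ht
        have ht' := Ioo_subset_Ioc_self ht
        have hf0 : ∀ v, 0 ≤ f t θ v := hfnn t ht' θ
        have hfc : Continuous (f t θ) := by
          rw [← continuousOn_univ]
          exact hfsm.continuousOn.comp (f := fun v : V3 => (t, θ, v)) (by fun_prop)
            fun _ _ => ⟨ht', mem_univ _⟩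
        have hfs : HasCompactSupport (f t θ) := by
          obtain ⟨R, hR⟩ := hfsupp t ht'
          refine HasCompactSupport.intro (isCompact_closedBall (0 : V3) R) fun v hv => hR θ v ?_
          simpa using hv
        rw [(hder t ht).deriv]
        exact log_deriv_nonneg (htp.trans ht.1) (hαpos t ht' θ).le (Real.exp_pos _).le
          (integral_nonneg fun v => mul_nonneg (hf0 v) (abs_nonneg _)) (Real.sqrt_nonneg _)
          (integral_div_abs_v0_le α ν U A (hαpos t ht' θ) hfc hfs hf0)
          (hnut t ht' θ) (halt t ht' θ)
    refine (Real.exp_monotone.comp_monotoneOn hL).congr fun t ht => ?_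
    have ht0 := htp.trans ht.1
    rw [Function.comp_apply, add_assoc, Real.exp_add, Real.exp_add, Real.rpow_def_of_pos ht0,
      mul_comm (Real.log t), ← Real.log_sqrt (hαpos t ht θ).le,
      Real.exp_log (Real.sqrt_pos.2 (hαpos t ht θ))]
  refine ⟨hmono, fun t ht θ => ?_⟩
  have h := hmono θ ht (right_mem_Ioc.2 hti) ht.2
  simp only at h
  have hle : tp ^ (b ^ 2 / 8) ≤ t ^ (b ^ 2 / 8) :=
    Real.rpow_le_rpow htp.le ht.1.le (by positivity)
  rw [Real.div_rpow (htp.trans hti).le htp.le, div_mul_eq_mul_div, div_mul_eq_mul_div,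
    le_div_iff₀ (Real.rpow_pos_of_pos htp _), mul_comm]
  refine le_trans ?_ h
  rw [mul_assoc]
  gcongr
end
end

section
/- There exists θ̄ ∈ [0,1] such that α(t,θ̄) is bounded on (t_p,t_i], i.e., sup_{t∈(t_p,t_i]} α(t,θ̄) < ∞; consequently ln α(t,θ̄) is bounded and the integral ∫_t^{t_i} (α_σ/α)(σ,θ̄) dσ is bounded uniformly for t ∈ (t_p,t_i]. -/
open MeasureTheory Set

noncomputable section

set_option linter.unusedVariables false

/-- A nested family of sublevel sets of continuous functions on a compact set has a common point. -/
theorem exists_forall_le_of_antitoneOn {X : Type*} [TopologicalSpace X] [T2Space X]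
    {K : Set X} (hK : IsCompact K) {s : Set ℝ} (hs : s.Nonempty) {M : ℝ} {f : ℝ → X → ℝ}
    (hcont : ∀ t ∈ s, ContinuousOn (f t) K) (hanti : ∀ x, AntitoneOn (fun t => f t x) s)
    (hmin : ∀ t ∈ s, ∃ x ∈ K, f t x ≤ M) :
    ∃ x ∈ K, ∀ t ∈ s, f t x ≤ M := by
  have hclosed : ∀ t : s, IsClosed (K ∩ f t ⁻¹' Iic M) := fun t =>
    (hcont t t.2).preimage_isClosed_of_isClosed hK.isClosed isClosed_Iic
  have : Nonempty s := hs.to_subtype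
  obtain ⟨x, hx⟩ := IsCompact.nonempty_iInter_of_directed_nonempty_isCompact_isClosed
    (fun t : s => K ∩ f t ⁻¹' Iic M)
    (Monotone.directed_ge fun a b hab x hx => ⟨hx.1, (hanti x a.2 b.2 hab).trans hx.2⟩)
    (fun t => (hmin t t.2).imp fun x hx => ⟨hx.1, hx.2⟩)
    (fun t => hK.of_isClosed_subset (hclosed t) inter_subset_left) hclosed
  rw [mem_iInter] at hx
  obtain ⟨t₀⟩ := this
  exact ⟨x, (hx t₀).1, fun t ht => (hx ⟨t, ht⟩).2⟩

/-- The logarithmic derivative of a positive nonincreasing function integrates to the difference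
of the logarithms. -/
theorem integral_deriv_div_self_of_deriv_nonpos {g : ℝ → ℝ} {a b : ℝ} (hab : a ≤ b)
    (hcont : ContinuousOn g (Icc a b)) (hdiff : ∀ x ∈ Ioo a b, DifferentiableAt ℝ g x)
    (hpos : ∀ x ∈ Icc a b, 0 < g x) (hderiv : ∀ x ∈ Ioo a b, deriv g x ≤ 0) :
    ∫ x in a..b, deriv g x / g x = Real.log (g b) - Real.log (g a) := by
  have hlog : ContinuousOn (fun x => Real.log (g x)) (Icc a b) :=
    hcont.log fun x hx => (hpos x hx).ne'
  have hd : ∀ x ∈ Ioo a b, HasDerivAt (fun x => Real.log (g x)) (deriv g x / g x) x :=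
    fun x hx => (hdiff x hx).hasDerivAt.log (hpos x (Ioo_subset_Icc_self hx)).ne'
  refine intervalIntegral.integral_eq_sub_of_hasDerivAt_of_le hab hlog hd ?_
  have h := intervalIntegral.intervalIntegrable_deriv_of_nonneg
    (g := fun x => -Real.log (g x)) (g' := fun x => -(deriv g x / g x)) (a := a) (b := b)
    (by rw [uIcc_of_le hab]; exact hlog.neg)
    (by rw [min_eq_left hab, max_eq_right hab]; exact fun x hx => (hd x hx).neg)
    (by
      rw [min_eq_left hab, max_eq_right hab]
      exact fun x hx => neg_nonneg.2 <|
        div_nonpos_of_nonpos_of_nonneg (hderiv x hx) (hpos x (Ioo_subset_Icc_self hx)).le)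
  simpa [Pi.neg_def] using h.neg

theorem alpha_bounded_at_some_theta
    (tp ti M : ℝ) (htp : 0 < tp) (hti : tp < ti)
    (α : ℝ → ℝ → ℝ)
    (hαsm : ContDiffOn ℝ (⊤ : ℕ∞) (fun p : ℝ × ℝ => α p.1 p.2) (Ioc tp ti ×ˢ (univ : Set ℝ)))
    (hαpos : ∀ t ∈ Ioc tp ti, ∀ θ : ℝ, 0 < α t θ)
    (hαper : ∀ t θ, α t (θ + 1) = α t θ)
    (hαdec : ∀ t ∈ Ioc tp ti, ∀ θ : ℝ, pt α t θ ≤ 0)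
    (hmin : ∀ t ∈ Ioc tp ti, ∃ θ ∈ Icc (0:ℝ) 1, α t θ ≤ M) :
    ∃ θb ∈ Icc (0:ℝ) 1, ∃ C : ℝ, ∀ t ∈ Ioc tp ti,
      α t θb ≤ C ∧ |Real.log (α t θb)| ≤ C
      ∧ |∫ σ in t..ti, pt α σ θb / α σ θb| ≤ C := by
  have hsec : ∀ θ, ContDiffOn ℝ (⊤ : ℕ∞) (fun t => α t θ) (Ioc tp ti) := fun θ =>
    hαsm.comp (g := fun p : ℝ × ℝ => α p.1 p.2) (f := fun t => (t, θ))
      (contDiff_id.prodMk contDiff_const).contDiffOn fun t ht => ⟨ht, mem_univ θ⟩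
  have hdiff : ∀ θ, ∀ t ∈ Ioo tp ti, DifferentiableAt ℝ (fun s => α s θ) t := fun θ t ht =>
    ((hsec θ).differentiableOn (by simp)).differentiableAt (Ioc_mem_nhds ht.1 ht.2)
  have hanti : ∀ θ, AntitoneOn (fun t => α t θ) (Ioc tp ti) := fun θ => by
    refine antitoneOn_of_deriv_nonpos (convex_Ioc tp ti) (hsec θ).continuousOn ?_ ?_ <;>
      rw [interior_Ioc]
    · exact fun t ht => (hdiff θ t ht).differentiableWithinAt
    · exact fun t ht => hαdec t (Ioo_subset_Ioc_self ht) θ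
  have hcont : ∀ t ∈ Ioc tp ti, ContinuousOn (α t) (Icc 0 1) := fun t ht =>
    hαsm.continuousOn.comp (g := fun p : ℝ × ℝ => α p.1 p.2) (f := fun θ => (t, θ))
      (by fun_prop) fun θ _ => ⟨ht, mem_univ θ⟩
  have hti_mem : ti ∈ Ioc tp ti := right_mem_Ioc.2 hti
  obtain ⟨θ, hθ, hM⟩ :=
    exists_forall_le_of_antitoneOn isCompact_Icc ⟨ti, hti_mem⟩ hcont hanti hmin
  refine ⟨θ, hθ, |M| + 2 * (|Real.log (α ti θ)| + |Real.log M|), fun t ht => ?_⟩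
  have hint : ∫ σ in t..ti, pt α σ θ / α σ θ = Real.log (α ti θ) - Real.log (α t θ) :=
    integral_deriv_div_self_of_deriv_nonpos (g := fun s => α s θ) ht.2
      ((hsec θ).continuousOn.mono fun s hs => ⟨ht.1.trans_le hs.1, hs.2⟩)
      (fun s hs => hdiff θ s ⟨ht.1.trans hs.1, hs.2⟩)
      (fun s hs => hαpos s ⟨ht.1.trans_le hs.1, hs.2⟩ θ)
      (fun s hs => hαdec s ⟨ht.1.trans hs.1, hs.2.le⟩ θ)
  have hlow : Real.log (α ti θ) ≤ Real.log (α t θ) :=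
    Real.log_le_log (hαpos ti hti_mem θ) (hanti θ ht hti_mem ht.2)
  have hupp : Real.log (α t θ) ≤ Real.log M := Real.log_le_log (hαpos t ht θ) (hM t ht)
  rw [hint]
  have h₁ := abs_nonneg M
  have h₂ := le_abs_self M
  have h₃ := abs_nonneg (Real.log M)
  have h₄ := le_abs_self (Real.log M)
  have h₅ := neg_abs_le (Real.log (α ti θ))
  have h₆ := le_abs_self (Real.log (α ti θ))
  have h₇ := hM t ht
  refine ⟨?_, abs_le.2 ⟨?_, ?_⟩, abs_le.2 ⟨?_, ?_⟩⟩ <;> linarith [abs_nonneg (Real.log (α ti θ))]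
end
end
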